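/- Let |β| < 4√2/(3π). Then for all sufficiently small γ > 0, the principal eigenvalue λ_{1,γ,0} of the operator L_{[γ,0]} = −d²/dy² + (U_{γ,0}'' − β)/U_{γ,0} on (−1,1) with Dirichlet boundary conditions is strictly positive. -/

import Mathlib

open MeasureTheory Real Set Filter

/-- The Gauss error function `erf(x) = (2/√π) ∫₀ˣ e^{-t²} dt`. -/
noncomputable def erf (x : ℝ) : ℝ := 2 / Real.sqrt π * ∫ t in (0:ℝ)..x, Real.exp (-t ^ 2)

/-- The modified shear profile
`U_{γ,a}(y) = y + (β/2) y² Ĩ(y/γ) + a γ² erf((y-5γ)/γ) Ĩ((y-5γ)/γ)`. -/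
noncomputable def Uprof (Icut : ℝ → ℝ) (β γ a : ℝ) (y : ℝ) : ℝ :=
  y + β / 2 * y ^ 2 * Icut (y / γ) + a * γ ^ 2 * erf ((y - 5 * γ) / γ) * Icut ((y - 5 * γ) / γ)

/-- Values of the quadratic form `∫_{-1}^1 (|φ'|² + q |φ|²)` over `L²`-normalized
`φ ∈ H₀¹(-1,1)`. -/
noncomputable def rqSet (q : ℝ → ℝ) : Set ℝ :=
  { r | ∃ φ dφ : ℝ → ℝ,
      (∀ y, HasDerivAt φ (dφ y) y) ∧ φ (-1) = 0 ∧ φ 1 = 0 ∧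
      IntervalIntegrable (fun y => dφ y ^ 2) volume (-1) 1 ∧
      IntervalIntegrable (fun y => q y * φ y ^ 2) volume (-1) 1 ∧
      (∫ y in (-1:ℝ)..1, φ y ^ 2) = 1 ∧
      r = ∫ y in (-1:ℝ)..1, (dφ y ^ 2 + q y * φ y ^ 2) }

/-- The principal eigenvalue `λ_{1,γ,a}` of the Rayleigh–Kuo operator
`L_{[γ,a]} = -d²/dy² + (U_{γ,a}'' - β)/U_{γ,a}` on `(-1,1)` with Dirichlet
boundary conditions, defined variationally. -/
noncomputable def lam1 (Icut : ℝ → ℝ) (β γ a : ℝ) : ℝ :=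
  sInf (rqSet (fun y => (iteratedDeriv 2 (Uprof Icut β γ a) y - β) / Uprof Icut β γ a y))

section QuadraticForm

variable {φ dφ : ℝ → ℝ} {a b : ℝ}

theorem measurable_of_forall_hasDerivAt (h : ∀ y, HasDerivAt φ (dφ y) y) : Measurable dφ := by
  have : dφ = deriv φ := funext fun y => (h y).deriv.symm
  rw [this]
  exact measurable_deriv φ

theorem intervalIntegrable_of_sq (hm : Measurable dφ)
    (hsq : IntervalIntegrable (fun y => dφ y ^ 2) volume a b) :
    IntervalIntegrable dφ volume a b := by
  refine (hsq.add (intervalIntegrable_const (c := (1 : ℝ)))).mono_fun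
    hm.aestronglyMeasurable (ae_of_all _ fun y => ?_)
  simp only [Real.norm_eq_abs]
  rw [abs_of_nonneg (by positivity : (0 : ℝ) ≤ dφ y ^ 2 + 1)]
  exact abs_le.2 ⟨by nlinarith [sq_nonneg (dφ y + 1)], by nlinarith [sq_nonneg (dφ y - 1)]⟩

/-- Cauchy–Schwarz for increments of a function with square-integrable derivative. -/
theorem sq_sub_le_mul_integral_sq (h : ∀ y, HasDerivAt φ (dφ y) y) (hab : a ≤ b)
    (hsq : IntervalIntegrable (fun y => dφ y ^ 2) volume a b) :
    (φ b - φ a) ^ 2 ≤ (b - a) * ∫ y in a..b, dφ y ^ 2 := by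
  have hint := intervalIntegrable_of_sq (measurable_of_forall_hasDerivAt h) hsq
  have hftc : ∫ y in a..b, dφ y = φ b - φ a :=
    intervalIntegral.integral_eq_sub_of_hasDerivAt (fun y _ => h y) hint
  rcases hab.eq_or_lt with rfl | hlt
  · simp
  set m := (φ b - φ a) / (b - a) with hm
  have hba : 0 < b - a := sub_pos.2 hlt
  have hnn : 0 ≤ ∫ y in a..b, (dφ y - m) ^ 2 :=
    intervalIntegral.integral_nonneg hab fun y _ => sq_nonneg _
  have hexp : ∫ y in a..b, (dφ y - m) ^ 2
      = (∫ y in a..b, dφ y ^ 2) - 2 * m * (φ b - φ a) + m ^ 2 * (b - a) := by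
    have : (fun y => (dφ y - m) ^ 2) = fun y => dφ y ^ 2 - 2 * m * dφ y + m ^ 2 := by
      ext y; ring
    rw [this, intervalIntegral.integral_add (hsq.sub (hint.const_mul _)) intervalIntegrable_const,
      intervalIntegral.integral_sub hsq (hint.const_mul _), intervalIntegral.integral_const_mul,
      hftc, intervalIntegral.integral_const, smul_eq_mul]
    ring
  have hmul : m * (b - a) = φ b - φ a := div_mul_cancel₀ _ hba.ne'
  rw [hexp, ← hmul] at hnn
  rw [← hmul]
  nlinarith [mul_nonneg hba.le hnn]

theorem sq_le_two_mul_energy (h : ∀ y, HasDerivAt φ (dφ y) y) (hl : φ (-1) = 0)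
    (hsq : IntervalIntegrable (fun y => dφ y ^ 2) volume (-1) 1) {y : ℝ} (hy : y ∈ Icc (-1 : ℝ) 1) :
    φ y ^ 2 ≤ 2 * ∫ t in (-1 : ℝ)..1, dφ t ^ 2 := by
  obtain ⟨h1, h2⟩ := hy
  have hA : IntervalIntegrable (fun t => dφ t ^ 2) volume (-1) y :=
    hsq.mono_set (by rw [uIcc_of_le h1, uIcc_of_le (by norm_num)]; exact Icc_subset_Icc_right h2)
  have hB : IntervalIntegrable (fun t => dφ t ^ 2) volume y 1 :=
    hsq.mono_set (by rw [uIcc_of_le h2, uIcc_of_le (by norm_num)]; exact Icc_subset_Icc_left h1)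
  have hadd := intervalIntegral.integral_add_adjacent_intervals hA hB
  have hBn : 0 ≤ ∫ t in y..1, dφ t ^ 2 := intervalIntegral.integral_nonneg h2 fun t _ => sq_nonneg _
  have hAn : 0 ≤ ∫ t in (-1)..y, dφ t ^ 2 :=
    intervalIntegral.integral_nonneg h1 fun t _ => sq_nonneg _
  have hcs := sq_sub_le_mul_integral_sq h h1 hA
  rw [hl, sub_zero] at hcs
  nlinarith

/-- The difference of squares at symmetric points is controlled by the Dirichlet energy. -/
theorem abs_sq_sub_sq_neg_le (h : ∀ y, HasDerivAt φ (dφ y) y) (hl : φ (-1) = 0)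
    (hr : φ 1 = 0) (hsq : IntervalIntegrable (fun y => dφ y ^ 2) volume (-1) 1) {y : ℝ} (hy : y ∈ Ioo (0 : ℝ) 1) :
    |φ y ^ 2 - φ (-y) ^ 2| ≤ √(y * (1 - y)) * ∫ t in (-1 : ℝ)..1, dφ t ^ 2 := by
  obtain ⟨h0, h1⟩ := hy
  have hA : IntervalIntegrable (fun t => dφ t ^ 2) volume (-1) (-y) :=
    hsq.mono_set (by
      rw [uIcc_of_le (by linarith), uIcc_of_le (by norm_num)]
      exact Icc_subset_Icc_right (by linarith))
  have hB : IntervalIntegrable (fun t => dφ t ^ 2) volume (-y) y :=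
    hsq.mono_set (by
      rw [uIcc_of_le (by linarith), uIcc_of_le (by norm_num)]
      exact Icc_subset_Icc (by linarith) (by linarith))
  have hC : IntervalIntegrable (fun t => dφ t ^ 2) volume y 1 :=
    hsq.mono_set (by
      rw [uIcc_of_le (by linarith), uIcc_of_le (by norm_num)]
      exact Icc_subset_Icc_left (by linarith))
  have hadd := intervalIntegral.integral_add_adjacent_intervals (hA.trans hB) hC
  rw [← intervalIntegral.integral_add_adjacent_intervals hA hB] at hadd
  have csA := sq_sub_le_mul_integral_sq h (by linarith) hA
  have csB := sq_sub_le_mul_integral_sq h (by linarith) hB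
  have csC := sq_sub_le_mul_integral_sq h (by linarith) hC
  rw [hl] at csA
  rw [hr] at csC
  have nB : 0 ≤ ∫ t in (-y)..y, dφ t ^ 2 :=
    intervalIntegral.integral_nonneg (by linarith) fun t _ => sq_nonneg _
  rw [← hadd]
  have nN : 0 ≤ ∫ t in (-1 : ℝ)..1, dφ t ^ 2 :=
    intervalIntegral.integral_nonneg (by norm_num) fun t _ => sq_nonneg _
  rw [← hadd] at nN
  generalize (∫ t in (-1)..(-y), dφ t ^ 2) = P at *
  generalize (∫ t in (-y)..y, dφ t ^ 2) = Q at *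
  generalize (∫ t in y..1, dφ t ^ 2) = R at *
  have hsum : (φ y + φ (-y)) ^ 2 ≤ 2 * (1 - y) * (P + R) := by
    nlinarith [sq_nonneg (φ y - φ (-y))]
  have hpr : 0 ≤ 2 * (1 - y) * (P + R) := (sq_nonneg _).trans hsum
  apply abs_le_of_sq_le_sq _ (by positivity)
  rw [mul_pow, Real.sq_sqrt (by nlinarith)]
  calc (φ y ^ 2 - φ (-y) ^ 2) ^ 2 = (φ y - φ (-y)) ^ 2 * (φ y + φ (-y)) ^ 2 := by ring
    _ ≤ ((y - -y) * Q) * (2 * (1 - y) * (P + R)) :=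
        mul_le_mul csB hsum (sq_nonneg _) (mul_nonneg (by linarith) nB)
    _ = y * (1 - y) * (4 * (Q * (P + R))) := by ring
    _ ≤ y * (1 - y) * (P + Q + R) ^ 2 := by
        apply mul_le_mul_of_nonneg_left _ (by nlinarith)
        nlinarith [sq_nonneg (Q - (P + R))]

end QuadraticForm

/-- If `q` is odd up to an error `s`, the form `∫ (|φ'|² + q |φ|²)` dominates a multiple of the
Dirichlet energy. -/
theorem le_of_mem_rqSet {q p s H : ℝ → ℝ} (hH : IntervalIntegrable H volume 0 1)
    (hpos : ∀ y ∈ Ioo (0 : ℝ) 1, |q y - p y| ≤ s y)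
    (hneg : ∀ y ∈ Ioo (0 : ℝ) 1, |q (-y) + p y| ≤ s y)
    (hbound : ∀ y ∈ Ioo (0 : ℝ) 1, |p y| * √(y * (1 - y)) + 4 * s y ≤ H y)
    (hlt : ∫ y in (0 : ℝ)..1, H y ≤ 1) {r : ℝ} (hr : r ∈ rqSet q) :
    (1 - ∫ y in (0 : ℝ)..1, H y) / 4 ≤ r := by
  obtain ⟨φ, dφ, hd, hφl, hφr, hsq, hqφ, hnorm, rfl⟩ := hr
  rw [intervalIntegral.integral_add hsq hqφ]
  set N := ∫ y in (-1 : ℝ)..1, dφ y ^ 2 with hN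
  have hcont : Continuous φ := continuous_iff_continuousAt.2 fun y => (hd y).continuousAt
  have hN4 : 1 / 4 ≤ N := by
    have : ∫ y in (-1 : ℝ)..1, φ y ^ 2 ≤ ∫ _ in (-1 : ℝ)..1, 2 * N :=
      intervalIntegral.integral_mono_on (by norm_num) ((hcont.pow 2).intervalIntegrable _ _)
        intervalIntegrable_const fun y hy => sq_le_two_mul_energy hd hφl hsq hy
    rw [hnorm, intervalIntegral.integral_const, smul_eq_mul] at this
    linarith
  have hqr : IntervalIntegrable (fun y => q y * φ y ^ 2) volume 0 1 :=
    hqφ.mono_set (by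
      rw [uIcc_of_le (by norm_num), uIcc_of_le (by norm_num)]
      exact Icc_subset_Icc_left (by norm_num))
  have hql : IntervalIntegrable (fun y => q y * φ y ^ 2) volume (-1) 0 :=
    hqφ.mono_set (by
      rw [uIcc_of_le (by norm_num), uIcc_of_le (by norm_num)]
      exact Icc_subset_Icc_right (by norm_num))
  have hqn : IntervalIntegrable (fun y => q (-y) * φ (-y) ^ 2) volume 0 1 := by
    simpa using (hql.comp_sub_left 0).symm
  have hsplit : ∫ y in (-1 : ℝ)..1, q y * φ y ^ 2
      = ∫ y in (0 : ℝ)..1, (q y * φ y ^ 2 + q (-y) * φ (-y) ^ 2) := by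
    rw [intervalIntegral.integral_add hqr hqn,
      intervalIntegral.integral_comp_neg (fun y => q y * φ y ^ 2),
      ← intervalIntegral.integral_add_adjacent_intervals hql hqr, neg_zero, add_comm]
  have hlow : ∫ y in (0 : ℝ)..1, -(H y * N)
      ≤ ∫ y in (0 : ℝ)..1, (q y * φ y ^ 2 + q (-y) * φ (-y) ^ 2) := by
    refine intervalIntegral.integral_mono_on_of_le_Ioo zero_le_one (hH.mul_const N).neg
      (hqr.add hqn) fun y hy => ?_
    have e1 := abs_sq_sub_sq_neg_le hd hφl hφr hsq hy
    have e2 := sq_le_two_mul_energy hd hφl hsq (y := y) ⟨by linarith [hy.1], hy.2.le⟩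
    have e3 := sq_le_two_mul_energy hd hφl hsq (y := -y) ⟨by linarith [hy.2], by linarith [hy.1]⟩
    rw [← hN] at e1 e2 e3
    have hs : 0 ≤ s y := (abs_nonneg _).trans (hpos y hy)
    have t1 : |p y * (φ y ^ 2 - φ (-y) ^ 2)| ≤ |p y| * (√(y * (1 - y)) * N) := by
      rw [abs_mul]; exact mul_le_mul_of_nonneg_left e1 (abs_nonneg _)
    have t2 : |(q y - p y) * φ y ^ 2| ≤ s y * (2 * N) := by
      rw [abs_mul, abs_of_nonneg (sq_nonneg (φ y))]
      exact mul_le_mul (hpos y hy) e2 (sq_nonneg _) hs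
    have t3 : |(q (-y) + p y) * φ (-y) ^ 2| ≤ s y * (2 * N) := by
      rw [abs_mul, abs_of_nonneg (sq_nonneg (φ (-y)))]
      exact mul_le_mul (hneg y hy) e3 (sq_nonneg _) hs
    have t4 := mul_le_mul_of_nonneg_right (hbound y hy) (by linarith : 0 ≤ N)
    have := neg_abs_le (p y * (φ y ^ 2 - φ (-y) ^ 2))
    have := neg_abs_le ((q y - p y) * φ y ^ 2)
    have := neg_abs_le ((q (-y) + p y) * φ (-y) ^ 2)
    nlinarith
  rw [intervalIntegral.integral_neg, intervalIntegral.integral_mul_const] at hlow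
  rw [hsplit]
  nlinarith

/-- A bounded measurable potential has admissible trial functions. -/
theorem rqSet_nonempty {q : ℝ → ℝ} {C : ℝ} (hq : Measurable q) (hC : ∀ y, |q y| ≤ C) :
    (rqSet q).Nonempty := by
  have hint : ∀ f : ℝ → ℝ, Continuous f →
      IntervalIntegrable (fun y => q y * f y) volume (-1) 1 := fun f hf =>
    ((hf.norm.const_mul C).intervalIntegrable (-1) 1).mono_fun
      (hq.mul hf.measurable).aestronglyMeasurable (ae_of_all _ fun y => by
        simp only [norm_mul, norm_norm]
        exact mul_le_mul_of_nonneg_right ((hC y).trans (le_abs_self C)) (norm_nonneg _))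
  refine ⟨_, fun y => √(15 / 16) * (1 - y ^ 2), fun y => √(15 / 16) * (-(2 * y)),
    fun y => ?_, by norm_num, by norm_num, ?_, hint _ (by fun_prop), ?_, rfl⟩
  · simpa using ((hasDerivAt_pow 2 y).const_sub 1).const_mul √(15 / 16)
  · exact Continuous.intervalIntegrable (by fun_prop) _ _
  · have : ∀ y : ℝ, (√(15 / 16) * (1 - y ^ 2)) ^ 2 = 15 / 16 - 15 / 8 * y ^ 2 + 15 / 16 * y ^ 4 := by
      intro y
      rw [mul_pow, Real.sq_sqrt (by norm_num)]
      ring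
    simp_rw [this]
    rw [intervalIntegral.integral_add, intervalIntegral.integral_sub]
    · simp only [intervalIntegral.integral_const_mul, integral_pow,
        intervalIntegral.integral_const, smul_eq_mul]
      norm_num
    all_goals exact Continuous.intervalIntegrable (by fun_prop) _ _

theorem exists_forall_abs_le {f : ℝ → ℝ} (hf : Continuous f) (h0 : ∀ s, 2 < |s| → f s = 0) :
    ∃ C, 0 ≤ C ∧ ∀ s, |f s| ≤ C := by
  obtain ⟨C, hC⟩ := (isCompact_Icc (a := (-2 : ℝ)) (b := 2)).exists_bound_of_continuousOn
    hf.continuousOn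
  refine ⟨|C|, abs_nonneg C, fun s => ?_⟩
  by_cases hs : 2 < |s|
  · simp [h0 s hs]
  · exact (hC s (abs_le.1 (not_lt.1 hs))).trans (le_abs_self C)

theorem sqrt_mul_one_sub_div_le {y : ℝ} (hy : y ∈ Ioo (0 : ℝ) 1) :
    √(y * (1 - y)) / y
      ≤ y ^ (-1 / 2 : ℝ) - 1 / 2 * y ^ (1 / 2 : ℝ) - 1 / 8 * y ^ (3 / 2 : ℝ) := by
  obtain ⟨h0, h1⟩ := hy
  have e1 : y ^ (1 / 2 : ℝ) = √y := (Real.sqrt_eq_rpow y).symm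
  have e2 : y ^ (-1 / 2 : ℝ) = (√y)⁻¹ := by
    rw [← e1, ← Real.rpow_neg h0.le]; norm_num
  have e3 : y ^ (3 / 2 : ℝ) = y * √y := by
    rw [← e1, ← Real.rpow_one_add' h0.le (by norm_num)]; norm_num
  have hs : √(1 - y) ≤ 1 - y / 2 - y ^ 2 / 8 := by
    apply Real.sqrt_le_iff.2
    constructor
    · nlinarith
    · nlinarith [pow_pos h0 3, pow_pos h0 4]
  have ht : 0 < √y := Real.sqrt_pos.2 h0
  have hyt : y = √y * √y := (Real.mul_self_sqrt h0.le).symm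
  rw [e1, e2, e3, Real.sqrt_mul h0.le]
  calc √y * √(1 - y) / y = √(1 - y) * (√y)⁻¹ := by
        nth_rewrite 3 [hyt]; field_simp
    _ ≤ (1 - y / 2 - y ^ 2 / 8) * (√y)⁻¹ := by gcongr
    _ = (√y)⁻¹ - 1 / 2 * √y - 1 / 8 * (y * √y) := by
        have : y * (√y)⁻¹ = √y := by nth_rewrite 1 [hyt]; field_simp
        linear_combination (-1 / 2 - y / 8) * this

/-- The majorant of the potential term, with integral `97 / 60 * c + 4 * d`. -/
theorem intervalIntegrable_and_integral_majorant (c d : ℝ) :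
    IntervalIntegrable (fun y : ℝ => c * (y ^ (-1 / 2 : ℝ) - 1 / 2 * y ^ (1 / 2 : ℝ)
        - 1 / 8 * y ^ (3 / 2 : ℝ)) + d * y ^ (-3 / 4 : ℝ)) volume 0 1 ∧
      ∫ y in (0 : ℝ)..1, (c * (y ^ (-1 / 2 : ℝ) - 1 / 2 * y ^ (1 / 2 : ℝ)
        - 1 / 8 * y ^ (3 / 2 : ℝ)) + d * y ^ (-3 / 4 : ℝ)) = 97 / 60 * c + 4 * d := by
  have i1 : IntervalIntegrable (fun y : ℝ => y ^ (-1 / 2 : ℝ)) volume 0 1 :=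
    intervalIntegral.intervalIntegrable_rpow' (by norm_num)
  have i2 : IntervalIntegrable (fun y : ℝ => y ^ (1 / 2 : ℝ)) volume 0 1 :=
    intervalIntegral.intervalIntegrable_rpow' (by norm_num)
  have i3 : IntervalIntegrable (fun y : ℝ => y ^ (3 / 2 : ℝ)) volume 0 1 :=
    intervalIntegral.intervalIntegrable_rpow' (by norm_num)
  have i4 : IntervalIntegrable (fun y : ℝ => y ^ (-3 / 4 : ℝ)) volume 0 1 :=
    intervalIntegral.intervalIntegrable_rpow' (by norm_num)
  have i12 := i1.sub (i2.const_mul (1 / 2))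
  have i123 := i12.sub (i3.const_mul (1 / 8))
  refine ⟨(i123.const_mul c).add (i4.const_mul d), ?_⟩
  rw [intervalIntegral.integral_add (i123.const_mul c) (i4.const_mul d),
    intervalIntegral.integral_const_mul, intervalIntegral.integral_const_mul,
    intervalIntegral.integral_sub i12 (i3.const_mul (1 / 8)),
    intervalIntegral.integral_sub i1 (i2.const_mul (1 / 2)),
    intervalIntegral.integral_const_mul, intervalIntegral.integral_const_mul,
    integral_rpow (by norm_num), integral_rpow (by norm_num), integral_rpow (by norm_num),
    integral_rpow (by norm_num)]
  norm_num
  ring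

theorem rpow_neg_half_le {δ y : ℝ} (h0 : 0 < y) (hy : y ≤ δ) :
    y ^ (-1 / 2 : ℝ) ≤ δ ^ (1 / 4 : ℝ) * y ^ (-3 / 4 : ℝ) := by
  have : y ^ (-1 / 2 : ℝ) = y ^ (1 / 4 : ℝ) * y ^ (-3 / 4 : ℝ) := by
    rw [← Real.rpow_add h0]; norm_num
  rw [this]
  gcongr

section Profile

variable {Icut : ℝ → ℝ} {β γ : ℝ}

theorem Uprof_zero_eq (y : ℝ) :
    Uprof Icut β γ 0 y = y * (1 + β / 2 * y * Icut (y / γ)) := by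
  simp only [Uprof]; ring

theorem contDiff_two_sq_mul (hI : ContDiff ℝ (⊤ : ℕ∞) Icut) :
    ContDiff ℝ (2 : ℕ) fun s => s ^ 2 * Icut s :=
  (contDiff_id.pow 2).mul (contDiff_infty.1 hI 2)

theorem iteratedDeriv_two_Uprof (hI : ContDiff ℝ (⊤ : ℕ∞) Icut) (hγ : γ ≠ 0) (y : ℝ) :
    iteratedDeriv 2 (Uprof Icut β γ 0) y
      = β / 2 * iteratedDeriv 2 (fun s => s ^ 2 * Icut s) (y / γ) := by
  have hW := contDiff_two_sq_mul hI
  have hU : Uprof Icut β γ 0 = (fun y => y) +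
      fun y => β / 2 * γ ^ 2 * (fun y => (fun s => s ^ 2 * Icut s) (γ⁻¹ * y)) y := by
    ext y
    simp only [Uprof_zero_eq, Pi.add_apply, div_eq_inv_mul y]
    field_simp
  rw [hU, iteratedDeriv_add contDiff_fun_id.contDiffAt (by
      exact (contDiff_const.mul (hW.comp (contDiff_const.mul contDiff_id))).contDiffAt),
    iteratedDeriv_const_mul_field, iteratedDeriv_comp_const_mul hW, iteratedDeriv_fun_id]
  simp only [div_eq_inv_mul y]
  field_simp
  norm_num

theorem continuous_iteratedDeriv_two_sq_mul (hI : ContDiff ℝ (⊤ : ℕ∞) Icut) :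
    Continuous (iteratedDeriv 2 fun s => s ^ 2 * Icut s) :=
  ContDiff.continuous_iteratedDeriv (n := (2 : ℕ)) 2
    (contDiff_two_sq_mul hI) le_rfl

theorem iteratedDeriv_two_sq_mul_neg (heven : ∀ x, Icut (-x) = Icut x) (s : ℝ) :
    iteratedDeriv 2 (fun s => s ^ 2 * Icut s) (-s)
      = iteratedDeriv 2 (fun s => s ^ 2 * Icut s) s := by
  have h := iteratedDeriv_comp_neg 2 (fun s => s ^ 2 * Icut s) s
  simp only [heven, neg_sq] at h
  simpa using h.symm

theorem iteratedDeriv_two_sq_mul_of_abs_lt_one (hone : ∀ x ∈ Set.Icc (-1 : ℝ) 1, Icut x = 1)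
    {s : ℝ} (hs : |s| < 1) : iteratedDeriv 2 (fun s => s ^ 2 * Icut s) s = 2 := by
  have : (fun s => s ^ 2 * Icut s) =ᶠ[nhds s] fun s => s ^ 2 := by
    filter_upwards [(isOpen_lt continuous_abs continuous_const).mem_nhds hs] with t ht
    rw [hone t (abs_le.1 (le_of_lt ht)), mul_one]
  rw [this.iteratedDeriv_eq]
  simp

theorem iteratedDeriv_two_sq_mul_of_two_lt_abs (hzero : ∀ x : ℝ, 2 ≤ |x| → Icut x = 0)
    {s : ℝ} (hs : 2 < |s|) : iteratedDeriv 2 (fun s => s ^ 2 * Icut s) s = 0 := by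
  have : (fun s => s ^ 2 * Icut s) =ᶠ[nhds s] fun _ => 0 := by
    filter_upwards [(isOpen_lt continuous_const continuous_abs).mem_nhds hs] with t ht
    rw [hzero t (le_of_lt ht), mul_zero]
  rw [this.iteratedDeriv_eq]
  simp

end Profile

theorem lam1_pos_of_small {Icut : ℝ → ℝ} {β γ M B : ℝ} (hI : ContDiff ℝ (⊤ : ℕ∞) Icut)
    (heven : ∀ x, Icut (-x) = Icut x) (hone : ∀ x ∈ Set.Icc (-1 : ℝ) 1, Icut x = 1)
    (hzero : ∀ x : ℝ, 2 ≤ |x| → Icut x = 0) (hB0 : 0 ≤ B) (hB : ∀ x, |Icut x| ≤ B)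
    (hM : ∀ s, |iteratedDeriv 2 (fun s => s ^ 2 * Icut s) s / 2 - 1| ≤ M) (hγ : 0 < γ)
    (hsmall : |β| * B * γ ≤ 1 / 2)
    (hlt : 97 / 60 * |β|
      + 4 * ((|β| * M + 4 * (|β| * M * (|β| * B))) * (2 * γ) ^ (1 / 4 : ℝ)) < 1) :
    0 < lam1 Icut β γ 0 := by
  set w := iteratedDeriv 2 (fun s => s ^ 2 * Icut s) with hw
  have hwc : Continuous w := continuous_iteratedDeriv_two_sq_mul hI
  have hM0 : 0 ≤ M := (abs_nonneg _).trans (hM 0)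
  set k : ℝ → ℝ := fun y => w (y / γ) / 2 - 1 with hk
  have hkM : ∀ y, |k y| ≤ M := fun y => hM _
  set e : ℝ → ℝ := fun y => β / 2 * y * Icut (y / γ) with he
  have he_abs : ∀ y, |e y| ≤ |β| / 2 * B * |y| := fun y => by
    simp only [he, abs_mul, abs_div, abs_two]
    nlinarith [mul_le_mul_of_nonneg_left (hB (y / γ)) (by positivity : 0 ≤ |β| / 2 * |y|)]
  have he_far : ∀ y, 2 * γ ≤ |y| → e y = 0 := fun y hy => by
    simp only [he]
    rw [hzero _ (by rwa [abs_div, abs_of_pos hγ, le_div_iff₀ hγ]), mul_zero]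
  have he_half : ∀ y, |e y| ≤ 1 / 2 := fun y => by
    rcases le_total (2 * γ) |y| with hy | hy
    · rw [he_far y hy]; norm_num
    · calc |e y| ≤ |β| / 2 * B * |y| := he_abs y
        _ ≤ |β| / 2 * B * (2 * γ) := by gcongr
        _ ≤ 1 / 2 := by linarith
  have hone_add : ∀ y, 1 / 2 ≤ 1 + e y := fun y => by linarith [(abs_le.1 (he_half y)).1]
  set q : ℝ → ℝ :=
    fun y => (iteratedDeriv 2 (Uprof Icut β γ 0) y - β) / Uprof Icut β γ 0 y with hq
  have hq_eq : ∀ y, q y = β * k y / (y * (1 + e y)) := fun y => by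
    simp only [hq, iteratedDeriv_two_Uprof hI hγ.ne', Uprof_zero_eq, hk, he, ← hw]
    ring
  have hq_meas : Measurable q := by
    have : q = fun y => β * k y / (y * (1 + e y)) := funext hq_eq
    rw [this]
    have hIc := hI.continuous
    have : Continuous k := by fun_prop
    have : Continuous e := by fun_prop
    fun_prop
  have hq_bdd : ∀ y, |q y| ≤ |β| * M / (γ * (1 / 2)) := fun y => by
    rw [hq_eq]
    rcases lt_or_ge |y| γ with hy | hy
    · have : k y = 0 := by
        simp only [hk, hw]
        rw [iteratedDeriv_two_sq_mul_of_abs_lt_one hone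
          (by rwa [abs_div, abs_of_pos hγ, div_lt_one hγ])]
        norm_num
      rw [this, mul_zero, zero_div, abs_zero]
      positivity
    · rw [abs_div, abs_mul, abs_mul, abs_of_nonneg (by linarith [hone_add y] : 0 ≤ 1 + e y)]
      have := hone_add y
      have := hkM y
      gcongr
  have hdiff : ∀ y, y ≠ 0 → |q y - β * k y / y| ≤ |β| * M * (|β| * B) := fun y hy => by
    have h1 : 0 < 1 + e y := by linarith [hone_add y]
    have : q y - β * k y / y = -(β * k y * (e y / y / (1 + e y))) := by
      rw [hq_eq]
      have := h1.ne'
      field_simp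
      ring
    rw [this, abs_neg, abs_mul, abs_mul, abs_div, abs_div, abs_of_pos h1]
    have h2 : |e y| / |y| ≤ |β| / 2 * B := (div_le_iff₀ (abs_pos.2 hy)).2 (he_abs y)
    have h3 : |e y| / |y| / (1 + e y) ≤ |β| * B := by
      rw [div_le_iff₀ h1]
      nlinarith [hone_add y, mul_nonneg (abs_nonneg β) hB0]
    have := hkM y
    gcongr
  have hdiff_far : ∀ y, 2 * γ < |y| → q y - β * k y / y = 0 := fun y hy => by
    rw [hq_eq, he_far y hy.le, add_zero, mul_one, sub_self]
  have hk_neg : ∀ y, k (-y) = k y := fun y => by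
    simp only [hk, hw, neg_div, iteratedDeriv_two_sq_mul_neg heven]
  have hcut : ∀ y ∈ Ioo (0 : ℝ) 1, y ≤ 2 * γ →
      1 ≤ (2 * γ) ^ (1 / 4 : ℝ) * y ^ (-3 / 4 : ℝ) := fun y hy hyγ =>
    (Real.one_le_rpow_of_pos_of_le_one_of_nonpos hy.1 hy.2.le (by norm_num)).trans
      (rpow_neg_half_le hy.1 hyγ)
  have herr : ∀ y ∈ Ioo (0 : ℝ) 1, ∀ z, |z| = y → |q z - β * k z / z|
      ≤ |β| * M * (|β| * B) * ((2 * γ) ^ (1 / 4 : ℝ) * y ^ (-3 / 4 : ℝ)) := by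
    rintro y hy z rfl
    have hz : 0 ≤ (2 * γ) ^ (1 / 4 : ℝ) * |z| ^ (-3 / 4 : ℝ) := by positivity
    rcases le_or_gt |z| (2 * γ) with h | h
    · exact (hdiff z (abs_pos.1 hy.1)).trans
        (le_mul_of_one_le_right (by positivity) (hcut _ hy h))
    · rw [hdiff_far z h, abs_zero]
      positivity
  obtain ⟨hHint, hHval⟩ := intervalIntegrable_and_integral_majorant |β|
    ((|β| * M + 4 * (|β| * M * (|β| * B))) * (2 * γ) ^ (1 / 4 : ℝ))
  have hlow : ∀ r ∈ rqSet q, _ ≤ r := fun r hr =>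
    le_of_mem_rqSet (p := fun y => β * k y / y)
      (s := fun y => |β| * M * (|β| * B) * ((2 * γ) ^ (1 / 4 : ℝ) * y ^ (-3 / 4 : ℝ)))
      hHint (fun y hy => herr y hy y (abs_of_pos hy.1))
      (fun y hy => by
        have := herr y hy (-y) (by rw [abs_neg, abs_of_pos hy.1])
        rwa [hk_neg, div_neg, sub_neg_eq_add] at this)
      (fun y hy => by
        have hy0 := hy.1
        have hG := sqrt_mul_one_sub_div_le hy
        have hG0 : 0 ≤ √(y * (1 - y)) / y := by positivity
        have hχ : 0 ≤ (2 * γ) ^ (1 / 4 : ℝ) * y ^ (-3 / 4 : ℝ) := by positivity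
        have hp : |β * k y / y| * √(y * (1 - y)) = |β| * |k y| * (√(y * (1 - y)) / y) := by
          rw [abs_div, abs_mul, abs_of_pos hy0]; ring
        suffices |β| * |k y| * (√(y * (1 - y)) / y) ≤ |β| * (y ^ (-1 / 2 : ℝ)
            - 1 / 2 * y ^ (1 / 2 : ℝ) - 1 / 8 * y ^ (3 / 2 : ℝ))
            + |β| * M * ((2 * γ) ^ (1 / 4 : ℝ) * y ^ (-3 / 4 : ℝ)) by
          rw [hp]; linarith
        rcases le_or_gt y (2 * γ) with h | h
        · have hle : √(y * (1 - y)) / y ≤ (2 * γ) ^ (1 / 4 : ℝ) * y ^ (-3 / 4 : ℝ) := by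
            refine hG.trans (le_trans ?_ (rpow_neg_half_le hy0 h))
            have : 0 ≤ y ^ (1 / 2 : ℝ) := by positivity
            have : 0 ≤ y ^ (3 / 2 : ℝ) := by positivity
            linarith
          have h1 : |β| * |k y| * (√(y * (1 - y)) / y)
              ≤ |β| * M * ((2 * γ) ^ (1 / 4 : ℝ) * y ^ (-3 / 4 : ℝ)) := by
            have := hkM y
            gcongr
          have h2 := mul_nonneg (abs_nonneg β) (hG0.trans hG)
          linarith
        · have hk1 : |k y| = 1 := by
            simp only [hk, hw]
            rw [iteratedDeriv_two_sq_mul_of_two_lt_abs hzero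
              (by rwa [abs_div, abs_of_pos hγ, abs_of_pos hy0, lt_div_iff₀ hγ])]
            norm_num
          have h1 := mul_le_mul_of_nonneg_left hG (abs_nonneg β)
          have h2 := mul_nonneg (mul_nonneg (abs_nonneg β) hM0) hχ
          rw [hk1, mul_one]
          linarith)
      (by rw [hHval]; exact hlt.le) hr
  have hpos := le_csInf (rqSet_nonempty hq_meas hq_bdd) hlow
  rw [hHval] at hpos
  refine lt_of_lt_of_le ?_ hpos
  linarith

/-- For `|β| < 4√2/(3π)`, the principal eigenvalue `λ_{1,γ,0}` of
`L_{[γ,0]} = -d²/dy² + (U_{γ,0}'' - β)/U_{γ,0}` is strictly positive for all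
sufficiently small `γ > 0`. -/
theorem lam1_pos_small_beta (Icut : ℝ → ℝ) (hsmooth : ContDiff ℝ (⊤ : ℕ∞) Icut)
    (heven : ∀ x, Icut (-x) = Icut x) (hnonneg : ∀ x, 0 ≤ Icut x)
    (hone : ∀ x ∈ Set.Icc (-1:ℝ) 1, Icut x = 1)
    (hzero : ∀ x : ℝ, 2 ≤ |x| → Icut x = 0)
    (β : ℝ) (hβ : |β| < 4 * Real.sqrt 2 / (3 * π)) :
    ∀ᶠ γ in nhdsWithin 0 (Set.Ioi 0), 0 < lam1 Icut β γ 0 := by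
  have hβ' : 97 / 60 * |β| < 1 := by
    have h2 : √2 < 1.4143 := (Real.sqrt_lt' (by norm_num)).2 (by norm_num)
    have hπ := Real.pi_gt_d2
    rw [lt_div_iff₀ (by positivity)] at hβ
    nlinarith [abs_nonneg β]
  obtain ⟨B, hB0, hB⟩ := exists_forall_abs_le hsmooth.continuous fun s hs => hzero s hs.le
  obtain ⟨C, -, hC⟩ := exists_forall_abs_le (continuous_iteratedDeriv_two_sq_mul hsmooth)
    fun s hs => iteratedDeriv_two_sq_mul_of_two_lt_abs hzero hs
  have hM : ∀ s, |iteratedDeriv 2 (fun s => s ^ 2 * Icut s) s / 2 - 1| ≤ C / 2 + 1 := fun s => by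
    refine (abs_sub _ _).trans ?_
    rw [abs_div, abs_two, abs_one]
    linarith [hC s]
  have c1 : Continuous fun γ : ℝ => |β| * B * γ := by fun_prop
  have c2 : Continuous fun γ : ℝ => 97 / 60 * |β| + 4 * ((|β| * (C / 2 + 1)
      + 4 * (|β| * (C / 2 + 1) * (|β| * B))) * (2 * γ) ^ (1 / 4 : ℝ)) := by
    have : Continuous fun γ : ℝ => (2 * γ) ^ (1 / 4 : ℝ) :=
      (continuous_const.mul continuous_id).rpow_const fun _ => Or.inr (by norm_num)
    fun_prop
  have t1 := (c1.tendsto 0).eventually_lt_const (u := 1 / 2) (by norm_num)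
  have t2 := (c2.tendsto 0).eventually_lt_const (u := 1) (by simpa using hβ')
  filter_upwards [self_mem_nhdsWithin, nhdsWithin_le_nhds t1, nhdsWithin_le_nhds t2]
    with γ hγ h1 h2
  exact lam1_pos_of_small hsmooth heven hone hzero hB0 hB hM hγ h1.le h2
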